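/- Let T be a finite tree with vertex set {1,…,V} (V ≥ 2) and edge set E(T), with |E(T)| = V−1, and assign to each edge {i,j} ∈ E(T) a multiplicity m(i,j) ∈ ℕ, m(i,j) ≥ 1. Fix α ∈ {0,1} and set h_m(t) = (1+α·ψ(t)²)^m e^{−ψ(t)²}. For n ∈ ℕ, N = 2n+1, and R > 0 define S(N,R) = Σ Π_{{i,j}∈E(T)} h_{m(i,j)}((s_i−s_j)/R), where the sum runs over all tuples (s_1,…,s_V) of pairwise distinct integers in {−n,…,n}. Then along any sequences N_m = 2n_m+1 → ∞, R_m → ∞ with R_m = o(N_m), one has S(N_m,R_m)/(N_m · R_m^{V−1}) → Π_{{i,j}∈E(T)} ∫_ℝ h_{m(i,j)}(t) dt. -/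

import Mathlib

open MeasureTheory Filter

theorem phi_anti (m : ℕ) (u v : ℝ) (hu : (m:ℝ) ≤ u) (huv : u ≤ v) :
    (1 + v) ^ m * Real.exp (-v) ≤ (1 + u) ^ m * Real.exp (-u) := by
  have hm : (0:ℝ) ≤ m := Nat.cast_nonneg m
  have h1 : 0 < 1 + u := by linarith
  have h2 : 1 + v ≤ (1 + u) * Real.exp ((v - u) / (1 + u)) := by
    have := Real.add_one_le_exp ((v - u) / (1 + u))
    have h3 : 1 + v = (1 + u) * ((v - u) / (1 + u) + 1) := by field_simp; ring
    rw [h3]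
    gcongr
  have h4 : (1 + v) ^ m ≤ (1 + u) ^ m * Real.exp (v - u) := by
    calc (1 + v) ^ m ≤ ((1 + u) * Real.exp ((v - u) / (1 + u))) ^ m := by
          apply pow_le_pow_left₀ (by linarith) h2
      _ = (1 + u) ^ m * Real.exp (m * ((v - u) / (1 + u))) := by
          rw [mul_pow, ← Real.exp_nat_mul]
      _ ≤ _ := by
          gcongr
          rw [← mul_div_assoc, div_le_iff₀ h1]
          nlinarith
  calc (1 + v) ^ m * Real.exp (-v) ≤ ((1 + u) ^ m * Real.exp (v - u)) * Real.exp (-v) := by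
        gcongr
    _ = _ := by rw [mul_assoc, ← Real.exp_add]; congr 2; ring

theorem exists_large (ψ : ℝ → ℝ)
    (hψpos : ∀ x, 0 < ψ x)
    (hint : Integrable (fun t => Real.exp (-(ψ t) ^ 2))) (m : ℕ) :
    ∃ t0 : ℝ, 0 ≤ t0 ∧ (m : ℝ) ≤ ψ t0 ^ 2 := by
  by_contra! hcon
  have h1 : IntegrableOn (fun _ : ℝ => Real.exp (-(m:ℝ))) (Set.Ioi 0) := by
    refine Integrable.mono' hint.integrableOn (by fun_prop) ?_
    refine (ae_restrict_iff' measurableSet_Ioi).2 (Eventually.of_forall fun t ht => ?_)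
    rw [Real.norm_of_nonneg (Real.exp_pos _).le]
    exact Real.exp_le_exp.2 (by linarith [hcon t (le_of_lt ht)])
  rw [integrableOn_const_iff] at h1
  simp at h1

/-- domination package -/
theorem exists_dom (a : ℝ) (ha : a = 0 ∨ a = 1)
    (ψ : ℝ → ℝ) (hψcont : Continuous ψ) (hψeven : ∀ x, ψ (-x) = ψ x)
    (hψpos : ∀ x, 0 < ψ x) (hψmono : MonotoneOn ψ (Set.Ici 0))
    (hψint : ∀ mm : ℕ, Integrable (fun t => (1 + a * ψ t ^ 2) ^ mm * Real.exp (-(ψ t) ^ 2)))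
    (m : ℕ) : ∃ H : ℝ → ℝ, Integrable H ∧ AntitoneOn H (Set.Ici 0) ∧ (∀ t, H |t| = H t) ∧
      ∀ t, (1 + a * ψ t ^ 2) ^ m * Real.exp (-(ψ t) ^ 2) ≤ H t := by
  obtain ⟨t0, ht0, hm⟩ := exists_large ψ hψpos (by simpa using hψint 0) m
  set h : ℝ → ℝ := fun t => (1 + a * ψ t ^ 2) ^ m * Real.exp (-(ψ t) ^ 2) with hh
  have hcont : Continuous h := by fun_prop
  have heven : ∀ t, h |t| = h t := by
    intro t
    rcases abs_choice t with e | e <;> rw [e]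
    simp [hh, hψeven]
  have hanti : ∀ s t, t0 ≤ s → s ≤ t → h t ≤ h s := by
    intro s t hs hst
    have e1 : ψ s ≤ ψ t := hψmono (ht0.trans hs) (ht0.trans (hs.trans hst)) hst
    have e2 : ψ t0 ≤ ψ s := hψmono ht0 (ht0.trans hs) hs
    have e3 : ψ s ^ 2 ≤ ψ t ^ 2 := pow_le_pow_left₀ (hψpos _).le e1 2
    have e4 : ψ t0 ^ 2 ≤ ψ s ^ 2 := pow_le_pow_left₀ (hψpos _).le e2 2
    rcases ha with rfl | rfl
    · simp only [hh, zero_mul, add_zero, one_pow, one_mul]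
      exact Real.exp_le_exp.2 (by linarith)
    · simp only [hh, one_mul]
      exact phi_anti m _ _ (hm.trans e4) e3
  obtain ⟨C, hC⟩ := (isCompact_Icc (a := -t0) (b := t0)).exists_bound_of_continuousOn
    hcont.continuousOn
  have hC1 : ∀ t, |t| ≤ t0 → h t ≤ C := fun t ht =>
    (le_abs_self _).trans (hC t (abs_le.1 ht))
  have hC2 : ∀ t, h t ≤ C := by
    intro t
    by_cases ht : |t| ≤ t0
    · exact hC1 t ht
    · rw [← heven]
      exact (hanti t0 |t| le_rfl (not_le.1 ht).le).trans (hC1 t0 (by rw [abs_of_nonneg ht0]))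
  refine ⟨(Set.Icc (-t0) t0).piecewise (fun _ => C) h, ?_, ?_, ?_, ?_⟩
  · refine Integrable.piecewise measurableSet_Icc ?_ (hψint m).integrableOn
    exact integrableOn_const (by simp)
  · intro s hs t ht hst
    simp only [Set.mem_Ici] at hs ht
    by_cases h1 : t ≤ t0
    · rw [Set.piecewise_eq_of_mem, Set.piecewise_eq_of_mem]
      · constructor <;> linarith
      · constructor <;> linarith
    · rw [Set.piecewise_eq_of_notMem _ _ _ (fun hx => h1 hx.2)]
      by_cases h2 : s ≤ t0
      · rw [Set.piecewise_eq_of_mem]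
        · exact hC2 t
        · constructor <;> linarith
      · rw [Set.piecewise_eq_of_notMem _ _ _ (fun hx => h2 hx.2)]
        exact hanti s t (not_le.1 h2).le hst
  · intro t
    simp only [Set.piecewise, Set.mem_Icc, ← abs_le, abs_abs, heven]
  · intro t
    simp only [Set.piecewise]
    split_ifs
    · exact hC2 t
    · exact le_rfl

theorem riemann (h H : ℝ → ℝ) (hc : Continuous h) (h0 : ∀ t, 0 ≤ h t)
    (hHint : Integrable H) (hHanti : AntitoneOn H (Set.Ici 0)) (hHabs : ∀ t, H |t| = H t)
    (hle : ∀ t, h t ≤ H t) (R : ℕ → ℝ) (K : ℕ → ℕ) (hR : Tendsto R atTop atTop)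
    (hK : Tendsto (fun m => (K m : ℝ) / R m) atTop atTop) :
    Tendsto (fun m => (∑ j ∈ Finset.Icc (-(K m : ℤ)) (K m), h ((j : ℝ) / R m)) / R m)
      atTop (nhds (∫ t, h t)) := by
  set g : ℕ → ℤ → ℝ := fun m j => if j ∈ Finset.Icc (-(K m : ℤ)) (K m) then h ((j:ℝ) / R m) else 0
    with hg
  have key : ∀ᶠ m in atTop, ∫ t, g m ⌊R m * t⌋ =
      (∑ j ∈ Finset.Icc (-(K m : ℤ)) (K m), h ((j : ℝ) / R m)) / R m := by
    filter_upwards [hR.eventually_gt_atTop 0] with m hm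
    rw [Measure.integral_comp_mul_left (fun x => g m ⌊x⌋) (R m), abs_of_pos (inv_pos.2 hm),
      smul_eq_mul, mul_comm, ← div_eq_mul_inv]
    congr 1
    have : (fun x : ℝ => g m ⌊x⌋) = fun x => ∑ j ∈ Finset.Icc (-(K m : ℤ)) (K m),
        (Set.Ico (j:ℝ) (j+1)).indicator (fun _ => h ((j:ℝ) / R m)) x := by
      funext x
      simp only [hg, Set.indicator, Set.mem_Ico, ← Int.floor_eq_iff]
      rw [Finset.sum_ite_eq]
    rw [this, integral_finsetSum]
    · refine Finset.sum_congr rfl fun j _ => ?_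
      rw [integral_indicator measurableSet_Ico]
      simp
    · intro j _
      rw [integrable_indicator_iff measurableSet_Ico]
      exact integrableOn_const (by simp)
  refine Tendsto.congr' key ?_
  refine tendsto_integral_filter_of_dominated_convergence
    (fun t => (Set.Icc (-1:ℝ) 1).indicator (fun _ => H 0) t + H (t - 1) + H (t + 1)) ?_ ?_ ?_ ?_
  · refine Eventually.of_forall fun m => ?_
    have : Measurable fun t : ℝ => g m ⌊R m * t⌋ :=
      (measurable_from_top (f := g m)).comp (Int.measurable_floor.comp (measurable_const_mul _))
    exact this.aestronglyMeasurable
  · have hHn : ∀ t, 0 ≤ H t := fun t => (h0 t).trans (hle t)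
    filter_upwards [hR.eventually_ge_atTop 1] with m hm
    refine Eventually.of_forall fun t => ?_
    have hm0 : 0 < R m := by linarith
    have i0 : 0 ≤ (Set.Icc (-1:ℝ) 1).indicator (fun _ => H 0) t :=
      Set.indicator_nonneg (fun _ _ => hHn 0) t
    have hb : ‖g m ⌊R m * t⌋‖ ≤ H ((⌊R m * t⌋ : ℝ) / R m) := by
      simp only [hg]
      split_ifs
      · rw [Real.norm_of_nonneg (h0 _)]; exact hle _
      · simpa using hHn _
    refine hb.trans ?_
    have f1 : (⌊R m * t⌋ : ℝ) / R m ≤ t := by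
      rw [div_le_iff₀ hm0]; linarith [Int.floor_le (R m * t)]
    have f2 : t - 1 ≤ (⌊R m * t⌋ : ℝ) / R m := by
      rw [le_div_iff₀ hm0]; nlinarith [Int.lt_floor_add_one (R m * t)]
    set y := (⌊R m * t⌋ : ℝ) / R m
    by_cases c1 : 1 < t
    · have : H y ≤ H (t - 1) := hHanti (by simp; linarith) (by simp; linarith) f2
      linarith [hHn (t+1)]
    by_cases c2 : t < -1
    · have : H |y| ≤ H |t + 1| := by
        refine hHanti (Set.mem_Ici.2 (abs_nonneg _)) (Set.mem_Ici.2 (abs_nonneg _)) ?_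
        rw [abs_of_neg (by linarith), abs_of_neg (by linarith)]; linarith
      rw [hHabs, hHabs] at this
      linarith [hHn (t-1)]
    · rw [Set.indicator_of_mem (by constructor <;> linarith)]
      have : H |y| ≤ H 0 := hHanti (by simp) (Set.mem_Ici.2 (abs_nonneg _)) (abs_nonneg _)
      rw [hHabs] at this
      linarith [hHn (t-1), hHn (t+1)]
  · refine Integrable.add (Integrable.add ?_ (hHint.comp_sub_right 1)) (hHint.comp_add_right 1)
    rw [integrable_indicator_iff measurableSet_Icc]
    exact integrableOn_const (by simp)
  · refine Eventually.of_forall fun t => ?_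
    have l1 : Tendsto (fun m => (⌊R m * t⌋ : ℝ) / R m) atTop (nhds t) := by
      have z : Tendsto (fun m => t - (R m)⁻¹) atTop (nhds t) := by
        simpa using (tendsto_inv_atTop_zero.comp hR).const_sub t
      refine tendsto_of_tendsto_of_tendsto_of_le_of_le' z tendsto_const_nhds ?_ ?_
      · filter_upwards [hR.eventually_gt_atTop 0] with m hm
        rw [le_div_iff₀ hm, sub_mul, inv_mul_cancel₀ hm.ne']
        linarith [Int.lt_floor_add_one (R m * t)]
      · filter_upwards [hR.eventually_gt_atTop 0] with m hm
        rw [div_le_iff₀ hm]; linarith [Int.floor_le (R m * t)]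
    refine ((hc.tendsto t).comp l1).congr' ?_
    filter_upwards [hR.eventually_gt_atTop 0, hK.eventually_ge_atTop (|t| + 1),
      l1.abs.eventually (gt_mem_nhds (lt_add_one |t|))] with m hm h1 h2
    simp only [hg, Function.comp]
    rw [if_pos]
    rw [Finset.mem_Icc, ← abs_le]
    have : |(⌊R m * t⌋ : ℝ)| ≤ K m := by
      have h3 := h2.le.trans h1
      rwa [abs_div, abs_of_pos hm, div_le_div_iff_of_pos_right hm] at h3
    exact_mod_cast this

theorem sum_snoc (k : ℕ) (T : Finset ℤ) (F : (Fin (k+1) → ℤ) → ℝ) :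
    ∑ s ∈ Fintype.piFinset (fun _ : Fin (k+1) => T), F s =
      ∑ s ∈ Fintype.piFinset (fun _ : Fin k => T), ∑ x ∈ T, F (Fin.snoc s x : Fin (k+1) → ℤ) := by
  rw [← Finset.sum_product']
  refine Finset.sum_nbij' (fun s => (fun i => s i.castSucc, s (Fin.last k)))
    (fun p => (Fin.snoc p.1 p.2 : Fin (k+1) → ℤ)) ?_ ?_ ?_ ?_ ?_
  · intro s hs
    simp only [Fintype.mem_piFinset] at hs
    simp [hs]
  · rintro ⟨s, x⟩ hs
    simp only [Finset.mem_product, Fintype.mem_piFinset] at hs ⊢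
    intro i
    refine Fin.lastCases ?_ (fun i => ?_) i
    · simpa using hs.2
    · simpa using hs.1 i
  · intro s _
    exact Fin.snoc_init_self s
  · rintro ⟨s, x⟩ _
    simp
  · intro s _
    congr 1
    exact (Fin.snoc_init_self s).symm

/-- product of weights along a rooted tree given by a parent function -/
noncomputable def wt (par : ℕ → ℕ) (hpar : ∀ i, par i ≤ i) (f : ℕ → ℤ → ℝ) (k : ℕ)
    (s : Fin (k+1) → ℤ) : ℝ :=
  ∏ i : Fin k, f i (s i.succ - s ⟨par i, by have := hpar i; omega⟩)

theorem wt_snoc (par : ℕ → ℕ) (hpar : ∀ i, par i ≤ i) (f : ℕ → ℤ → ℝ) (k : ℕ)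
    (s : Fin (k+1) → ℤ) (x : ℤ) :
    wt par hpar f (k+1) (Fin.snoc s x : Fin (k+2) → ℤ) =
      wt par hpar f k s * f k (x - s ⟨par k, by have := hpar k; omega⟩) := by
  unfold wt
  rw [Fin.prod_univ_castSucc]
  have e : ∀ (j : ℕ) (hj : j < k + 1) (hj' : j < k + 2),
      (Fin.snoc s x : Fin (k+2) → ℤ) ⟨j, hj'⟩ = s ⟨j, hj⟩ := by
    intro j hj hj'
    exact Fin.snoc_castSucc (α := fun _ => ℤ) x s ⟨j, hj⟩
  congr 1
  · refine Finset.prod_congr rfl fun i _ => ?_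
    have := hpar i
    rw [Fin.succ_castSucc, Fin.snoc_castSucc]
    simp only [Fin.val_castSucc]
    rw [e (par i) (by omega)]
  · have := hpar k
    rw [Fin.succ_last, Fin.snoc_last]
    simp only [Fin.val_last]
    rw [e (par k) (by omega)]

theorem wt_nonneg (par : ℕ → ℕ) (hpar : ∀ i, par i ≤ i) (f : ℕ → ℤ → ℝ)
    (f0 : ∀ i x, 0 ≤ f i x) (k : ℕ) (s : Fin (k+1) → ℤ) : 0 ≤ wt par hpar f k s :=
  Finset.prod_nonneg fun _ _ => f0 _ _

theorem upper (par : ℕ → ℕ) (hpar : ∀ i, par i ≤ i) (f : ℕ → ℤ → ℝ)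
    (f0 : ∀ i x, 0 ≤ f i x) (n : ℕ) (k : ℕ) :
    ∑ s ∈ Fintype.piFinset (fun _ : Fin (k+1) => Finset.Icc (-(n:ℤ)) n), wt par hpar f k s ≤
      (2 * (n:ℝ) + 1) * ∏ i : Fin k, ∑ j ∈ Finset.Icc (-((2 * n : ℕ):ℤ)) ((2 * n : ℕ) : ℤ), f i j := by
  induction k with
  | zero =>
    simp only [wt, Finset.univ_eq_empty, Finset.prod_empty, mul_one, Finset.sum_const,
      Fintype.card_piFinset_const, Int.card_Icc, nsmul_eq_mul]
    have : ((n:ℤ) + 1 - -(n:ℤ)).toNat = 2 * n + 1 := by omega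
    rw [this]
    simp
  | succ k ih =>
    rw [sum_snoc, Fin.prod_univ_castSucc, ← mul_assoc]
    simp only [Fin.val_castSucc, Fin.val_last]
    refine le_trans ?_ (mul_le_mul_of_nonneg_right ih (Finset.sum_nonneg fun _ _ => f0 _ _))
    rw [Finset.sum_mul]
    refine Finset.sum_le_sum fun s hs => ?_
    simp only [wt_snoc, ← Finset.mul_sum]
    refine mul_le_mul_of_nonneg_left ?_ (wt_nonneg par hpar f f0 k s)
    have hy := Fintype.mem_piFinset.1 hs ⟨par k, by have := hpar k; omega⟩
    set y := s ⟨par k, by have := hpar k; omega⟩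
    rw [← Finset.sum_image (f := f k) (g := fun x => x - y) (s := Finset.Icc (-(n:ℤ)) n)]
    · refine Finset.sum_le_sum_of_subset_of_nonneg ?_ fun _ _ _ => f0 _ _
      intro z hz
      simp only [Finset.mem_image, Finset.mem_Icc] at hz hy ⊢
      obtain ⟨x, hx, rfl⟩ := hz
      push_cast
      omega
    · intro a _ b _ hab
      simpa using hab

theorem snoc_inj (k : ℕ) (s : Fin k → ℤ) (x : ℤ) (hs : Function.Injective s)
    (hx : ∀ i, s i ≠ x) : Function.Injective (Fin.snoc s x : Fin (k+1) → ℤ) := by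
  intro i j
  refine Fin.lastCases ?_ (fun i => ?_) i <;> refine Fin.lastCases ?_ (fun j => ?_) j
  · simp
  · simpa using fun h => (hx j h.symm).elim
  · simpa using fun h => (hx i h).elim
  · simpa using fun h => hs h

open Classical in
theorem lower (par : ℕ → ℕ) (hpar : ∀ i, par i ≤ i) (f : ℕ → ℤ → ℝ)
    (f0 : ∀ i x, 0 ≤ f i x) (C D : ℝ) (C0 : 0 ≤ C) (K : ℕ) (k : ℕ)
    (fC : ∀ i : Fin k, ∀ x, f i x ≤ C) (hD : (k + 1 : ℝ) * C ≤ D) (n : ℤ) :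
    (max 0 (2 * (n - k * K : ℝ) + 1)) *
      ∏ i : Fin k, max 0 ((∑ j ∈ Finset.Icc (-(K:ℤ)) K, f i j) - D) ≤
    ∑ s ∈ Fintype.piFinset (fun _ : Fin (k+1) => Finset.Icc (-n) n),
      if Function.Injective s then wt par hpar f k s else 0 := by
  induction k generalizing n with
  | zero =>
    have hi : ∀ s : Fin (0+1) → ℤ, Function.Injective s := fun s i j _ => Fin.ext (by omega)
    simp only [wt, Finset.univ_eq_empty, Finset.prod_empty, mul_one, hi, if_true, Finset.sum_const,
      Fintype.card_piFinset_const, Int.card_Icc, nsmul_eq_mul]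
    have : (((n + 1 - -n).toNat : ℤ) : ℝ) = ((max (2 * n + 1) 0 : ℤ) : ℝ) := by
      rw [Int.toNat_eq_max]; congr 2; ring
    simp only [Int.cast_natCast] at this
    simp only [zero_add, pow_one, this]
    push_cast
    rw [max_comm]; simp
  | succ k ih =>
    rw [sum_snoc, Fin.prod_univ_castSucc, ← mul_assoc]
    simp only [Fin.val_castSucc, Fin.val_last]
    have ih' := ih (fun i => fC i.castSucc) (by push_cast at hD; nlinarith) (n - K)
    have e : (2 * (((n - K : ℤ) : ℝ) - k * K) + 1) = 2 * ((n:ℝ) - ((k + 1 : ℕ) : ℝ) * K) + 1 := by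
      push_cast; ring
    rw [e] at ih'
    refine (mul_le_mul_of_nonneg_right ih' (le_max_left _ _)).trans ?_
    rw [Finset.sum_mul]
    refine (Finset.sum_le_sum fun s hs => ?_).trans
      (Finset.sum_le_sum_of_subset_of_nonneg (s := Fintype.piFinset
        (fun _ : Fin (k+1) => Finset.Icc (-(n-K)) (n-K))) ?_ ?_)
    · split_ifs with hinj
      swap
      · rw [zero_mul]
        refine Finset.sum_nonneg fun x _ => ?_
        split_ifs
        · exact wt_nonneg par hpar f f0 _ _
        · exact le_rfl
      have hy := Fintype.mem_piFinset.1 hs ⟨par k, by have := hpar k; omega⟩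
      set y := s ⟨par k, by have := hpar k; omega⟩ with hyd
      have hw := wt_nonneg par hpar f f0 k s
      have step : wt par hpar f k s * max 0 ((∑ j ∈ Finset.Icc (-(K:ℤ)) K, f k j) - D) ≤
          wt par hpar f k s *
            ∑ x ∈ (Finset.Icc (-n) n) \ Finset.univ.image s, f k (x - y) := by
        refine mul_le_mul_of_nonneg_left (max_le (Finset.sum_nonneg fun _ _ => f0 _ _) ?_) hw
        have h1 : ∑ j ∈ Finset.Icc (-(K:ℤ)) K, f k j ≤ ∑ x ∈ Finset.Icc (-n) n, f k (x - y) := by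
          rw [← Finset.sum_image (f := f k) (g := fun x => x - y) (s := Finset.Icc (-n) n)]
          · refine Finset.sum_le_sum_of_subset_of_nonneg ?_ fun _ _ _ => f0 _ _
            intro z hz
            simp only [Finset.mem_image, Finset.mem_Icc] at hz hy ⊢
            exact ⟨z + y, by omega, by ring⟩
          · intro a _ b _ hab
            simpa using hab
        have h2 : ∑ x ∈ Finset.Icc (-n) n, f k (x - y) ≤
            ∑ x ∈ (Finset.Icc (-n) n) \ Finset.univ.image s, f k (x - y) +
              ∑ x ∈ Finset.univ.image s, f k (x - y) := by
          rw [← Finset.sum_union Finset.sdiff_disjoint]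
          refine Finset.sum_le_sum_of_subset_of_nonneg ?_ fun _ _ _ => f0 _ _
          intro z hz
          simp only [Finset.mem_union, Finset.mem_sdiff]
          tauto
        have h3 : ∑ x ∈ Finset.univ.image s, f k (x - y) ≤ D := by
          have c1 : (Finset.univ.image s).card ≤ k + 1 := by
            simpa using Finset.card_image_le (s := (Finset.univ : Finset (Fin (k+1)))) (f := s)
          have c2 : ((Finset.univ.image s).card : ℝ) ≤ k + 1 := by exact_mod_cast c1
          have := Finset.sum_le_card_nsmul (Finset.univ.image s) (fun x => f k (x - y)) C
            (fun x _ => fC (Fin.last k) _)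
          rw [nsmul_eq_mul] at this
          push_cast at hD
          nlinarith
        linarith
      refine step.trans ?_
      rw [Finset.mul_sum]
      refine (Finset.sum_le_sum fun x hx => ?_).trans
        (Finset.sum_le_sum_of_subset_of_nonneg Finset.sdiff_subset ?_)
      · simp only [Finset.mem_sdiff, Finset.mem_image, Finset.mem_univ, true_and, not_exists] at hx
        rw [if_pos (snoc_inj _ s x hinj hx.2), wt_snoc]
      · intro x _ _
        split_ifs
        · exact wt_nonneg par hpar f f0 _ _
        · exact le_rfl
    · refine Fintype.piFinset_subset _ _ fun _ => Finset.Icc_subset_Icc ?_ ?_ <;> omega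
    · intro s _ _
      refine Finset.sum_nonneg fun x _ => ?_
      split_ifs
      · exact wt_nonneg par hpar f f0 _ _
      · exact le_rfl

/-- Tree ordering. -/
theorem tree_order (k : ℕ) (G : SimpleGraph (Fin (k+1))) [DecidableRel G.Adj]
    (hconn : G.Connected) (hE : G.edgeFinset.card = k) :
    ∃ (e : Fin (k+1) ≃ Fin (k+1)) (par : ℕ → ℕ) (hpar : ∀ i, par i ≤ i),
      ∀ F : Fin (k+1) → Fin (k+1) → ℝ, (∀ i j, F i j = F j i) →
        ∏ p ∈ Finset.univ.filter (fun p : Fin (k+1) × Fin (k+1) => p.1 < p.2 ∧ G.Adj p.1 p.2),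
          F p.1 p.2 =
        ∏ i : Fin k, F (e i.succ) (e ⟨par i, by have := hpar i; omega⟩) := by
  have hpar0 : ∀ v : Fin (k+1), v ≠ 0 → ∃ w, G.Adj v w ∧ G.dist w 0 < G.dist v 0 := by
    intro v hv
    obtain ⟨p, hp⟩ := hconn.exists_walk_length_eq_dist v 0
    cases p with
    | nil => exact (hv rfl).elim
    | cons h q =>
      refine ⟨_, h, ?_⟩
      rw [← hp, SimpleGraph.Walk.length_cons]
      exact Nat.lt_succ_of_le (SimpleGraph.dist_le q)
  set d : Fin (k+1) → ℕ := fun v => G.dist v 0 with hd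
  set e : Equiv.Perm (Fin (k+1)) := Tuple.sort d with he
  have hmono : Monotone (d ∘ e) := Tuple.monotone_sort d
  have he0 : e 0 = 0 := by
    have h1 : d (e 0) ≤ d (e (e.symm 0)) := hmono (Fin.zero_le _)
    rw [Equiv.apply_symm_apply] at h1
    have h2 : d 0 = 0 := by simp [hd]
    have h3 : G.dist (e 0) 0 = 0 := by
      have : d (e 0) = 0 := by omega
      exact this
    exact (hconn.dist_eq_zero_iff).1 h3
  have hne : ∀ i : Fin k, e i.succ ≠ 0 := by
    intro i h
    rw [← he0] at h
    exact Fin.succ_ne_zero i (e.injective h)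
  choose! w hw1 hw2 using hpar0
  have hwlt : ∀ i : Fin k, (e.symm (w (e i.succ))) < i.succ := by
    intro i
    by_contra! h
    have h1 := hmono h
    simp only [Function.comp, Equiv.apply_symm_apply] at h1
    exact absurd (hw2 _ (hne i)) (not_lt.2 h1)
  refine ⟨e, fun i => if h : i < k then (e.symm (w (e (⟨i, h⟩ : Fin k).succ)) : ℕ) else 0, ?_, ?_⟩
  · intro i
    dsimp only
    split_ifs with h
    · have := hwlt ⟨i, h⟩
      rw [Fin.lt_def] at this
      simp only [Fin.val_succ] at this
      omega
    · exact Nat.zero_le _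
  intro F hF
  have hp : ∀ (i : Fin k) (hlt), e ⟨(if h : (i:ℕ) < k then
      (e.symm (w (e (⟨i, h⟩ : Fin k).succ)) : ℕ) else 0), hlt⟩ = w (e i.succ) := by
    intro i hlt
    rw [← Equiv.eq_symm_apply]
    ext
    simp
  simp only [hp]
  set P := Finset.univ.filter (fun p : Fin (k+1) × Fin (k+1) => p.1 < p.2 ∧ G.Adj p.1 p.2) with hP
  have hPc : P.card ≤ k := by
    refine le_trans ?_ hE.le
    refine Finset.card_le_card_of_injOn (fun p => s(p.1, p.2)) ?_ ?_
    · intro p hp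
      simp only [hP, Finset.coe_filter, Finset.mem_univ, true_and, Set.mem_setOf_eq] at hp
      simpa using hp.2
    · rintro ⟨p1, p2⟩ hp ⟨q1, q2⟩ hq h
      simp only [hP, Finset.coe_filter, Finset.mem_univ, true_and, Set.mem_setOf_eq] at hp hq
      simp only [Sym2.eq_iff] at h
      rcases h with ⟨rfl, rfl⟩ | ⟨rfl, rfl⟩
      · rfl
      · exact absurd hp.1 (not_lt.2 hq.1.le)
  set q : Fin k → Fin (k+1) × Fin (k+1) := fun i =>
    if e i.succ < w (e i.succ) then (e i.succ, w (e i.succ)) else (w (e i.succ), e i.succ) with hq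
  have hqF : ∀ i, F (e i.succ) (w (e i.succ)) = F (q i).1 (q i).2 := by
    intro i
    simp only [hq]
    split_ifs
    · rfl
    · exact hF _ _
  have hqmem : ∀ i ∈ (Finset.univ : Finset (Fin k)), q i ∈ P := by
    intro i _
    have ha := hw1 _ (hne i)
    simp only [hP, Finset.mem_filter, Finset.mem_univ, true_and, hq]
    split_ifs with h
    · exact ⟨h, ha⟩
    · exact ⟨lt_of_le_of_ne (not_lt.1 h) ha.ne', ha.symm⟩
  have hqinj : Function.Injective q := by
    intro i j hij
    have hs : s(e i.succ, w (e i.succ)) = s(e j.succ, w (e j.succ)) := by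
      have : ∀ i, s(e i.succ, w (e i.succ)) = s((q i).1, (q i).2) := by
        intro i
        simp only [hq]
        split_ifs
        · rfl
        · exact Sym2.eq_swap
      rw [this, this, hij]
    rw [Sym2.eq_iff] at hs
    rcases hs with ⟨h, _⟩ | ⟨h1, h2⟩
    · exact Fin.succ_injective _ (e.injective h)
    · have a1 := hw2 _ (hne i)
      have a2 := hw2 _ (hne j)
      rw [h2] at a1
      rw [← h1] at a2
      omega
  symm
  refine Finset.prod_bij (fun i _ => q i) hqmem (fun i _ j _ h => hqinj h) ?_ (fun i _ => hqF i)
  intro b hb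
  have := Finset.surj_on_of_inj_on_of_card_le (s := (Finset.univ : Finset (Fin k))) (t := P)
    (fun i _ => q i) hqmem (fun i j _ _ h => hqinj h) (by simpa using hPc) b hb
  obtain ⟨i, hi, rfl⟩ := this
  exact ⟨i, hi, rfl⟩

theorem scales (n : ℕ → ℕ) (R : ℕ → ℝ) (hR : Tendsto R atTop atTop)
    (hRN : Tendsto (fun m => R m / (2 * (n m : ℝ) + 1)) atTop (nhds 0)) :
    Tendsto (fun m => ((2 * n m : ℕ) : ℝ) / R m) atTop atTop ∧
    ∃ K : ℕ → ℕ, Tendsto (fun m => (K m : ℝ) / R m) atTop atTop ∧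
      Tendsto (fun m => (K m : ℝ) / (2 * (n m : ℝ) + 1)) atTop (nhds 0) := by
  have hpos : ∀ m, 0 < 2 * (n m : ℝ) + 1 := fun m => by positivity
  have h1 : Tendsto (fun m => (2 * (n m : ℝ) + 1) / R m) atTop atTop := by
    have : Tendsto (fun m => R m / (2 * (n m : ℝ) + 1)) atTop (nhdsWithin 0 (Set.Ioi 0)) := by
      refine tendsto_nhdsWithin_iff.2 ⟨hRN, ?_⟩
      filter_upwards [hR.eventually_gt_atTop 0] with m hm
      exact div_pos hm (hpos m)
    refine (tendsto_inv_nhdsGT_zero.comp this).congr fun m => ?_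
    simp
  have hinv : Tendsto (fun m => (R m)⁻¹) atTop (nhds 0) := tendsto_inv_atTop_zero.comp hR
  constructor
  · refine (h1.atTop_add hinv.neg).congr fun m => ?_
    push_cast
    ring
  refine ⟨fun m => ⌊√((2 * (n m : ℝ) + 1) * R m)⌋₊, ?_, ?_⟩
  · have h2 : Tendsto (fun m => √((2 * (n m : ℝ) + 1) / R m)) atTop atTop :=
      Real.tendsto_sqrt_atTop.comp h1
    refine tendsto_atTop_mono' _ ?_ (h2.atTop_add hinv.neg)
    filter_upwards [hR.eventually_gt_atTop 0] with m hm
    rw [le_div_iff₀ hm, add_mul, neg_mul, inv_mul_cancel₀ hm.ne']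
    have e : √((2 * (n m : ℝ) + 1) / R m) * R m = √((2 * (n m : ℝ) + 1) * R m) := by
      rw [Real.sqrt_div (hpos m).le, Real.sqrt_mul (hpos m).le]
      have h3 := Real.sqrt_pos.2 hm
      rw [div_mul_eq_mul_div, div_eq_iff h3.ne', mul_assoc, Real.mul_self_sqrt hm.le]
    rw [e]
    linarith [Nat.lt_floor_add_one (√((2 * (n m : ℝ) + 1) * R m))]
  · have h2 : Tendsto (fun m => √(R m / (2 * (n m : ℝ) + 1))) atTop (nhds 0) := by
      simpa using hRN.sqrt
    refine squeeze_zero' (Eventually.of_forall fun m => by positivity) ?_ h2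
    filter_upwards [hR.eventually_gt_atTop 0] with m hm
    rw [div_le_iff₀ (hpos m)]
    refine (Nat.floor_le (Real.sqrt_nonneg _)).trans (le_of_eq ?_)
    rw [Real.sqrt_div hm.le, Real.sqrt_mul (hpos m).le]
    have h3 := Real.sqrt_pos.2 (hpos m)
    rw [div_mul_eq_mul_div, eq_div_iff h3.ne', mul_right_comm, Real.mul_self_sqrt (hpos m).le,
      mul_comm]

/-- Lemma 4.2: for a tree `T` on vertex set `{1,…,V}` with edge multiplicities `m(i,j) ≥ 1`,
the normalized sum
`S(N,R)/(N R^{V-1})`, where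
`S(N,R) = Σ_{(s₁,…,s_V) pairwise distinct in {-n,…,n}} Π_{{i,j} ∈ E(T)} h_{m(i,j)}((s_i-s_j)/R)`
and `h_m(t) = (1+α ψ(t)²)^m e^{-ψ(t)²}`, converges to `Π_{{i,j} ∈ E(T)} ∫ h_{m(i,j)}(t) dt`
as `N, R → ∞` with `R = o(N)`. -/
theorem stmt18
    (V : ℕ) (hV : 2 ≤ V) (G : SimpleGraph (Fin V)) [DecidableRel G.Adj]
    (hTree : G.IsTree) (hE : G.edgeFinset.card = V - 1)
    (mult : Fin V → Fin V → ℕ) (hmsymm : ∀ i j, mult i j = mult j i)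
    (hmpos : ∀ i j, G.Adj i j → 1 ≤ mult i j)
    (a : ℝ) (ha : a = 0 ∨ a = 1)
    (ψ : ℝ → ℝ) (hψcont : Continuous ψ) (hψeven : ∀ x, ψ (-x) = ψ x)
    (hψpos : ∀ x, 0 < ψ x) (hψmono : MonotoneOn ψ (Set.Ici 0))
    (hψint : ∀ mm : ℕ, Integrable (fun t => (1 + a * ψ t ^ 2) ^ mm * Real.exp (-(ψ t) ^ 2)))
    (n : ℕ → ℕ) (R : ℕ → ℝ)
    (hn : Tendsto n atTop atTop) (hR : Tendsto R atTop atTop)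
    (hRN : Tendsto (fun m => R m / (2 * (n m : ℝ) + 1)) atTop (nhds 0)) :
    Tendsto (fun m =>
        (∑ s ∈ Finset.univ.filter
            (fun s : Fin V → (Finset.Icc (-(n m : ℤ)) (n m : ℤ) : Finset ℤ) =>
              Function.Injective s),
          ∏ p ∈ Finset.univ.filter (fun p : Fin V × Fin V => p.1 < p.2 ∧ G.Adj p.1 p.2),
            (1 + a * ψ ((((s p.1 : ℤ) : ℝ) - ((s p.2 : ℤ) : ℝ)) / R m) ^ 2) ^ mult p.1 p.2 *
              Real.exp (-(ψ ((((s p.1 : ℤ) : ℝ) - ((s p.2 : ℤ) : ℝ)) / R m)) ^ 2)) /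
          ((2 * (n m : ℝ) + 1) * R m ^ (V - 1)))
      atTop
      (nhds (∏ p ∈ Finset.univ.filter (fun p : Fin V × Fin V => p.1 < p.2 ∧ G.Adj p.1 p.2),
        ∫ t, (1 + a * ψ t ^ 2) ^ mult p.1 p.2 * Real.exp (-(ψ t) ^ 2))) := by
  obtain ⟨k, rfl⟩ : ∃ k, V = k + 1 := ⟨V - 1, by omega⟩
  simp only [Nat.add_sub_cancel] at hE ⊢
  obtain ⟨e, par, hpar, hprod⟩ := tree_order k G hTree.connected hE
  obtain ⟨hK1, K, hK2, hK3⟩ := scales n R hR hRN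
  set h : ℕ → ℝ → ℝ := fun m t => (1 + a * ψ t ^ 2) ^ m * Real.exp (-(ψ t) ^ 2) with hh
  have ha0 : 0 ≤ a := by rcases ha with rfl | rfl <;> norm_num
  have hcont : ∀ m, Continuous (h m) := fun m => by fun_prop
  have h0 : ∀ m t, 0 ≤ h m t := fun m t => by positivity
  have heven : ∀ m t, h m (-t) = h m t := fun m t => by simp only [hh, hψeven]
  choose H hH1 hH2 hH3 hH4 using exists_dom a ha ψ hψcont hψeven hψpos hψmono hψint
  have hbd : ∀ m t, h m t ≤ H m 0 := by
    intro m t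
    refine (hH4 m t).trans ?_
    rw [← hH3]
    exact hH2 m (by simp) (Set.mem_Ici.2 (abs_nonneg _)) (abs_nonneg _)
  have hH0 : ∀ m, 0 ≤ H m 0 := fun m => (h0 m 0).trans (hbd m 0)
  have hRS : ∀ (q : ℕ) (L : ℕ → ℕ), Tendsto (fun m => (L m : ℝ) / R m) atTop atTop →
      Tendsto (fun m => (∑ j ∈ Finset.Icc (-(L m : ℤ)) (L m), h q ((j : ℝ) / R m)) / R m)
        atTop (nhds (∫ t, h q t)) := fun q L hL =>
    riemann (h q) (H q) (hcont q) (h0 q) (hH1 q) (hH2 q) (hH3 q) (hH4 q) R L hR hL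
  set mu : ℕ → ℕ := fun i => if hi : i < k then
    mult (e ⟨i + 1, by omega⟩) (e ⟨par i, by have := hpar i; omega⟩) else 0 with hmu
  have hmu' : ∀ i : Fin k, mult (e i.succ) (e ⟨par i, by have := hpar i; omega⟩) = mu i := by
    intro i
    simp only [hmu, i.2, dif_pos]
    rfl
  set f : ℕ → ℕ → ℤ → ℝ := fun m i x => h (mu i) ((x : ℝ) / R m) with hf
  have f0 : ∀ m i x, 0 ≤ f m i x := fun m i x => h0 _ _
  have hlim : (∏ p ∈ Finset.univ.filter
      (fun p : Fin (k+1) × Fin (k+1) => p.1 < p.2 ∧ G.Adj p.1 p.2),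
        ∫ t, (1 + a * ψ t ^ 2) ^ mult p.1 p.2 * Real.exp (-(ψ t) ^ 2)) =
      ∏ i : Fin k, ∫ t, h (mu i) t := by
    rw [hprod (fun i j => ∫ t, h (mult i j) t) (fun i j => by simp only [hmsymm i j])]
    simp only [hmu']
  have hsum : ∀ m, (∑ s ∈ Finset.univ.filter
            (fun s : Fin (k+1) → (Finset.Icc (-(n m : ℤ)) (n m : ℤ) : Finset ℤ) =>
              Function.Injective s),
          ∏ p ∈ Finset.univ.filter
            (fun p : Fin (k+1) × Fin (k+1) => p.1 < p.2 ∧ G.Adj p.1 p.2),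
            (1 + a * ψ ((((s p.1 : ℤ) : ℝ) - ((s p.2 : ℤ) : ℝ)) / R m) ^ 2) ^ mult p.1 p.2 *
              Real.exp (-(ψ ((((s p.1 : ℤ) : ℝ) - ((s p.2 : ℤ) : ℝ)) / R m)) ^ 2)) =
      ∑ s ∈ Fintype.piFinset (fun _ : Fin (k+1) => Finset.Icc (-(n m : ℤ)) (n m)),
        if Function.Injective s then wt par hpar (f m) k s else 0 := by
    intro m
    rw [← Finset.sum_filter]
    refine Finset.sum_bij (fun s _ => fun i => ((s (e i) : _) : ℤ)) ?_ ?_ ?_ ?_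
    · intro s hs
      simp only [Finset.mem_filter, Finset.mem_univ, true_and, Fintype.mem_piFinset] at hs ⊢
      exact ⟨fun i => (s (e i)).2, fun i j hij => e.injective (hs (Subtype.ext hij))⟩
    · intro s _ t _ hst
      funext i
      have := congrFun hst (e.symm i)
      simp only [Equiv.apply_symm_apply] at this
      exact Subtype.ext this
    · intro t ht
      simp only [Finset.mem_filter, Fintype.mem_piFinset] at ht
      refine ⟨fun i => ⟨t (e.symm i), ht.1 _⟩, ?_, ?_⟩
      · simp only [Finset.mem_filter, Finset.mem_univ, true_and]
        intro i j hij
        exact e.symm.injective (ht.2 (congrArg Subtype.val hij))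
      · funext i
        simp
    · intro s _
      rw [hprod (fun i j => h (mult i j) ((((s i : ℤ) : ℝ) - ((s j : ℤ) : ℝ)) / R m))]
      · unfold wt
        refine Finset.prod_congr rfl fun i _ => ?_
        simp only [hmu', hf]
        push_cast
        rfl
      · intro i j
        rw [hmsymm i j, ← heven, ← neg_div, neg_sub]
  rw [hlim]
  simp only [hsum]
  have hN : ∀ m, 0 < 2 * (n m : ℝ) + 1 := fun m => by positivity
  -- constants for the lower bound
  set C : ℝ := ∑ i : Fin k, H (mu i) 0 with hC
  have hC0 : 0 ≤ C := Finset.sum_nonneg fun i _ => hH0 _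
  have hfC : ∀ m, ∀ i : Fin k, ∀ x, f m i x ≤ C := by
    intro m i x
    exact (hbd _ _).trans
      (Finset.single_le_sum (f := fun i : Fin k => H (mu i) 0) (fun i _ => hH0 _)
        (Finset.mem_univ i))
  set D : ℝ := (k + 1 : ℝ) * C with hD
  have hinv : Tendsto (fun m => (R m)⁻¹) atTop (nhds 0) := tendsto_inv_atTop_zero.comp hR
  have lowlim : Tendsto (fun m => max 0 (1 - 2 * k * ((K m : ℝ) / (2 * (n m : ℝ) + 1))) *
      ∏ i : Fin k, max 0 ((∑ j ∈ Finset.Icc (-(K m : ℤ)) (K m), h (mu i) ((j : ℝ) / R m)) / R m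
        - D * (R m)⁻¹)) atTop (nhds (∏ i : Fin k, ∫ t, h (mu i) t)) := by
    have l1 : Tendsto (fun m => max 0 (1 - 2 * k * ((K m : ℝ) / (2 * (n m : ℝ) + 1)))) atTop
        (nhds 1) := by
      have := (tendsto_const_nhds (x := (0:ℝ))).max ((hK3.const_mul (2 * k : ℝ)).const_sub 1)
      simpa using this
    have l2 : Tendsto (fun m => ∏ i : Fin k,
        max 0 ((∑ j ∈ Finset.Icc (-(K m : ℤ)) (K m), h (mu i) ((j : ℝ) / R m)) / R m
        - D * (R m)⁻¹)) atTop (nhds (∏ i : Fin k, ∫ t, h (mu i) t)) := by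
      refine tendsto_finset_prod _ fun i _ => ?_
      have := (tendsto_const_nhds (x := (0:ℝ))).max ((hRS (mu i) K hK2).sub (hinv.const_mul D))
      rwa [mul_zero, sub_zero, max_eq_right (integral_nonneg (h0 _))] at this
    simpa using l1.mul l2
  have uplim : Tendsto (fun m => ∏ i : Fin k,
      ((∑ j ∈ Finset.Icc (-((2 * n m : ℕ) : ℤ)) ((2 * n m : ℕ) : ℤ),
        h (mu i) ((j : ℝ) / R m)) / R m)) atTop (nhds (∏ i : Fin k, ∫ t, h (mu i) t)) :=
    tendsto_finset_prod _ fun i _ => hRS (mu i) (fun m => 2 * n m) hK1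
  refine tendsto_of_tendsto_of_tendsto_of_le_of_le' lowlim uplim ?_ ?_
  · filter_upwards [hR.eventually_gt_atTop 0] with m hm
    have hl := lower par hpar (f m) (f0 m) C D hC0 (K m) k (hfC m) le_rfl (n m)
    rw [le_div_iff₀ (mul_pos (hN m) (pow_pos hm k))]
    refine le_trans (le_of_eq ?_) (hl.trans (le_of_eq ?_))
    · have e1 : max 0 (1 - 2 * k * ((K m : ℝ) / (2 * (n m : ℝ) + 1))) * (2 * (n m : ℝ) + 1) =
          max 0 (2 * (((n m : ℤ) : ℝ) - k * K m) + 1) := by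
        rw [max_mul_of_nonneg _ _ (hN m).le, zero_mul]
        congr 1
        have := (hN m).ne'
        push_cast
        field_simp
        ring
      have e2 : (∏ i : Fin k, max 0 ((∑ j ∈ Finset.Icc (-(K m : ℤ)) (K m),
          h (mu i) ((j : ℝ) / R m)) / R m - D * (R m)⁻¹)) * R m ^ k =
          ∏ i : Fin k, max 0 ((∑ j ∈ Finset.Icc (-(K m:ℤ)) (K m), f m i j) - D) := by
        have : R m ^ k = ∏ _i : Fin k, R m := by simp
        rw [this, ← Finset.prod_mul_distrib]
        refine Finset.prod_congr rfl fun i _ => ?_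
        rw [max_mul_of_nonneg _ _ hm.le, zero_mul, sub_mul, div_mul_cancel₀ _ hm.ne',
          inv_mul_cancel_right₀ hm.ne']
      rw [mul_mul_mul_comm, e1, e2]
    · refine Finset.sum_congr rfl fun s _ => ?_
      congr
  · filter_upwards [hR.eventually_gt_atTop 0] with m hm
    rw [div_le_iff₀ (mul_pos (hN m) (pow_pos hm k))]
    have hu := upper par hpar (f m) (f0 m) (n m) k
    refine le_trans (Finset.sum_le_sum fun s _ => ?_) (hu.trans (le_of_eq ?_))
    · split_ifs
      · exact le_rfl
      · exact wt_nonneg par hpar _ (f0 m) _ _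
    · have e2 : (∏ i : Fin k, ((∑ j ∈ Finset.Icc (-((2 * n m : ℕ) : ℤ)) ((2 * n m : ℕ) : ℤ),
          h (mu i) ((j : ℝ) / R m)) / R m)) * R m ^ k =
          ∏ i : Fin k, ∑ j ∈ Finset.Icc (-((2 * n m : ℕ) : ℤ)) ((2 * n m : ℕ) : ℤ), f m i j := by
        have : R m ^ k = ∏ _i : Fin k, R m := by simp
        rw [this, ← Finset.prod_mul_distrib]
        refine Finset.prod_congr rfl fun i _ => ?_
        rw [div_mul_cancel₀ _ hm.ne']
      rw [mul_left_comm, e2]
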